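/- arXiv:1211.0181 — 2 statements merged into one kernel-verified Lean document; each statement's English description precedes it below -/
import Mathlib

section
/- Suppose in addition that Σᵢ fᵢ(λ) λᵢ ≥ 0 for all λ ∈ Γ. Then for every σ > sup_{∂Γ} f with Γ^σ ≠ ∅ there exists δ_σ > 0 such that Σᵢ fᵢ(λ) ≥ δ_σ for every λ ∈ ∂Γ^σ. More precisely, for every A > 0 and every λ ∈ ∂Γ^σ one has A Σᵢ fᵢ(λ) ≥ f(A·𝟙) − σ, where 𝟙 = (1, …, 1) ∈ Γ, and there exists A > 0 with f(A·𝟙) > σ. -/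
open Filter Set

noncomputable def euclNorm {n : ℕ} (x : Fin n → ℝ) : ℝ := Real.sqrt (∑ i, x i ^ 2)

/-- The `i`-th partial derivative `f_i = ∂f/∂λ_i`. -/
noncomputable def pd {n : ℕ} (f : (Fin n → ℝ) → ℝ) (x : Fin n → ℝ) (i : Fin n) : ℝ :=
  fderiv ℝ f x (Pi.single i 1)

/-- A concave function lies below its tangent hyperplane at a point of differentiability. -/
theorem ConcaveOn.le_add_fderiv {E : Type*} [NormedAddCommGroup E] [NormedSpace ℝ E]
    {s : Set E} {f : E → ℝ} {x y : E} (hf : ConcaveOn ℝ s f) (hx : x ∈ s) (hy : y ∈ s)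
    (hd : DifferentiableAt ℝ f x) : f y ≤ f x + fderiv ℝ f x (y - x) := by
  have hg := hf.comp_affineMap (AffineMap.lineMap x y : ℝ →ᵃ[ℝ] E)
  have hline : HasDerivAt (AffineMap.lineMap x y : ℝ → E) (y - x) 0 :=
    AffineMap.hasDerivAt_lineMap
  have hderiv : HasDerivAt (f ∘ (AffineMap.lineMap x y : ℝ → E)) (fderiv ℝ f x (y - x)) 0 := by
    refine HasFDerivAt.comp_hasDerivAt (0 : ℝ) ?_ hline
    simpa using hd.hasFDerivAt
  have h := hg.slope_le_of_hasDerivAt (x := 0) (y := 1) (by simpa using hx) (by simpa using hy)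
    one_pos hderiv
  simp only [slope_def_field, Function.comp_apply, AffineMap.lineMap_apply_one,
    AffineMap.lineMap_apply_zero, sub_zero, div_one] at h
  linarith

theorem fderiv_apply_eq_sum_pd {n : ℕ} (f : (Fin n → ℝ) → ℝ) (x v : Fin n → ℝ) :
    fderiv ℝ f x v = ∑ i, pd f x i * v i := by
  conv_lhs => rw [pi_eq_sum_univ' v, map_sum]
  refine Finset.sum_congr rfl fun i _ => ?_
  rw [map_smul, smul_eq_mul, mul_comm, pd]

/-- If `Σ_i f_i(λ) λ_i ≥ 0` on `Γ`, then `Σ_i f_i` is bounded below by a positive constant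
`δ_σ` on `∂Γ^σ`; more precisely `A Σ_i f_i(λ) ≥ f(A·𝟙) - σ` for all `A > 0` and
`λ ∈ ∂Γ^σ`, and `f(A·𝟙) > σ` for some `A > 0`. -/
theorem sum_fi_bounded_below
    (n : ℕ) (hn : 2 ≤ n) (Γ : Set (Fin n → ℝ))
    (hΓopen : IsOpen Γ) (hΓconv : Convex ℝ Γ)
    (hΓcone : ∀ t : ℝ, 0 < t → ∀ x ∈ Γ, t • x ∈ Γ)
    (hΓsymm : ∀ π : Equiv.Perm (Fin n), ∀ x ∈ Γ, x ∘ π ∈ Γ)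
    (hΓpos : {x : Fin n → ℝ | ∀ i, 0 < x i} ⊆ Γ)
    (hΓproper : Γ ≠ Set.univ) (hΓbd : (frontier Γ).Nonempty)
    (f : (Fin n → ℝ) → ℝ)
    (hf1 : ContDiffOn ℝ 1 f Γ)
    (hfsymm : ∀ π : Equiv.Perm (Fin n), ∀ x ∈ Γ, f (x ∘ π) = f x)
    (hfpos : ∀ x ∈ Γ, ∀ i, 0 < pd f x i)
    (hfconc : ConcaveOn ℝ Γ f)
    (hsum : ∀ x ∈ Γ, 0 ≤ ∑ i, pd f x i * x i) :
    ∀ σ : ℝ, (∀ μ₀ ∈ frontier Γ, Filter.limsup f (nhdsWithin μ₀ Γ) < σ) →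
      {x | x ∈ Γ ∧ σ < f x}.Nonempty →
      ((∃ δ : ℝ, 0 < δ ∧ ∀ l ∈ Γ, f l = σ → δ ≤ ∑ i, pd f l i) ∧
       (∀ A : ℝ, 0 < A → ∀ l ∈ Γ, f l = σ →
          f (fun _ => A) - σ ≤ A * ∑ i, pd f l i) ∧
       (∃ A : ℝ, 0 < A ∧ σ < f (fun _ => A))) := by
  intro σ _ ⟨x, hx, hσx⟩
  have tangent : ∀ l ∈ Γ, ∀ y ∈ Γ, f y ≤ f l + ∑ i, pd f l i * (y i - l i) := fun l hl y hy => by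
    have h := hfconc.le_add_fderiv hl hy
      ((hf1.differentiableOn one_ne_zero).differentiableAt (hΓopen.mem_nhds hl))
    simpa only [fderiv_apply_eq_sum_pd, Pi.sub_apply] using h
  have diag_mem : ∀ A : ℝ, 0 < A → (fun _ => A) ∈ Γ := fun A hA => hΓpos fun _ => hA
  have bound : ∀ A : ℝ, 0 < A → ∀ l ∈ Γ, f l = σ →
      f (fun _ => A) - σ ≤ A * ∑ i, pd f l i := by
    intro A hA l hl hlσ
    have h := tangent l hl _ (diag_mem A hA)
    have hs := hsum l hl
    simp only [mul_sub, Finset.sum_sub_distrib, ← Finset.sum_mul] at h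
    linarith
  have large : ∃ A : ℝ, 0 < A ∧ σ < f (fun _ => A) := by
    refine ⟨‖x‖ + 1, by positivity, hσx.trans_le ?_⟩
    have hmem := diag_mem (‖x‖ + 1) (by positivity)
    have h := tangent _ hmem x hx
    have hle : ∑ i, pd f (fun _ => ‖x‖ + 1) i * (x i - (‖x‖ + 1)) ≤ 0 := by
      refine Finset.sum_nonpos fun i _ => mul_nonpos_of_nonneg_of_nonpos (hfpos _ hmem i).le ?_
      have := (le_abs_self (x i)).trans (norm_le_pi_norm x i)
      linarith
    linarith
  refine ⟨?_, bound, large⟩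
  obtain ⟨A, hA, hσA⟩ := large
  refine ⟨(f (fun _ => A) - σ) / A, div_pos (sub_pos.2 hσA) hA, fun l hl hlσ => ?_⟩
  rw [div_le_iff₀' hA]
  exact bound A hA l hl hlσ
end

section
/- Let μ ∈ ∂Γ^σ and R > |μ|. Then the set ∂B_R(0) ∩ ∂Γ^σ is compact, and Θ_R(μ) = 0 if and only if there exists λ ∈ ∂B_R(0) ∩ ∂Γ^σ such that the open segment (μ, λ) := {t μ + (1−t) λ : 0 < t < 1} is contained in ∂Γ^σ. -/
open Filter Set

/-- `Θ_R(μ) = inf_{λ ∈ ∂B_R(0) ∩ ∂Γ^σ} max_{0 ≤ t ≤ 1} (f(tμ + (1-t)λ) - σ)`. -/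
noncomputable def Theta {n : ℕ} (Γ : Set (Fin n → ℝ)) (f : (Fin n → ℝ) → ℝ) (σ : ℝ)
    (μ : Fin n → ℝ) (R : ℝ) : ℝ :=
  sInf ((fun l => sSup ((fun t : ℝ => f (t • μ + (1 - t) • l) - σ) '' Set.Icc 0 1)) ''
    {l | euclNorm l = R ∧ l ∈ Γ ∧ f l = σ})

lemma euclNorm_eq_norm {n : ℕ} (x : Fin n → ℝ) : euclNorm x = ‖WithLp.toLp 2 x‖ := by
  simp [euclNorm, EuclideanSpace.norm_eq]

lemma continuous_euclNorm {n : ℕ} : Continuous (euclNorm : (Fin n → ℝ) → ℝ) := by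
  unfold euclNorm
  fun_prop

lemma abs_apply_le_euclNorm {n : ℕ} (x : Fin n → ℝ) (i : Fin n) : |x i| ≤ euclNorm x :=
  Real.abs_le_sqrt (Finset.single_le_sum (f := fun i => x i ^ 2) (fun _ _ => sq_nonneg _)
    (Finset.mem_univ i))

lemma isPreconnected_euclNorm_sphere {n : ℕ} (hn : 2 ≤ n) (R : ℝ) :
    IsPreconnected {x : Fin n → ℝ | euclNorm x = R} := by
  have hrank : 1 < Module.rank ℝ (EuclideanSpace ℝ (Fin n)) := by
    rw [← Module.finrank_eq_rank, finrank_euclideanSpace_fin]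
    exact_mod_cast hn
  have h := (isPreconnected_sphere hrank 0 R).image (fun x => WithLp.ofLp x)
    (PiLp.continuous_ofLp 2 _).continuousOn
  convert h using 1
  ext x
  simp only [mem_ofPred_eq, euclNorm_eq_norm, mem_image, mem_sphere_zero_iff_norm]
  exact ⟨fun hx => ⟨WithLp.toLp 2 x, hx, rfl⟩, by rintro ⟨y, hy, rfl⟩; exact hy⟩

/-- A concave function on an open convex set is bounded above near every point of the closure. -/
lemma ConcaveOn.isBoundedUnder_nhdsWithin {E : Type*} [AddCommGroup E] [Module ℝ E]
    [TopologicalSpace E] [IsTopologicalAddGroup E] [ContinuousSMul ℝ E]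
    {Γ : Set E} {f : E → ℝ} (hf : ConcaveOn ℝ Γ f) (hΓ : IsOpen Γ) (hfc : ContinuousOn f Γ)
    (hne : Γ.Nonempty) {x : E} (hx : x ∈ closure Γ) :
    IsBoundedUnder (· ≤ ·) (nhdsWithin x Γ) f := by
  obtain ⟨z, hz⟩ := hne
  have hm : (1 / 2 : ℝ) • z + (1 / 2 : ℝ) • x ∈ Γ := by
    have := hf.1.combo_interior_closure_mem_interior (hΓ.interior_eq.symm ▸ hz) hx
      (by norm_num : (0 : ℝ) < 1 / 2) (by norm_num : (0 : ℝ) ≤ 1 / 2) (by norm_num)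
    rwa [hΓ.interior_eq] at this
  have hc : Tendsto (fun y => f ((1 / 2 : ℝ) • z + (1 / 2 : ℝ) • y)) (nhds x)
      (nhds (f ((1 / 2 : ℝ) • z + (1 / 2 : ℝ) • x))) := by
    have h1 : ContinuousAt f ((1 / 2 : ℝ) • z + (1 / 2 : ℝ) • x) :=
      hfc.continuousAt (hΓ.mem_nhds hm)
    refine h1.tendsto.comp (Continuous.tendsto ?_ x)
    fun_prop
  refine ⟨2 * (f ((1 / 2 : ℝ) • z + (1 / 2 : ℝ) • x) + 1) - f z, ?_⟩
  rw [eventually_map]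
  filter_upwards [nhdsWithin_le_nhds (hc.eventually_lt_const (lt_add_one _)),
    self_mem_nhdsWithin] with y hy hyΓ
  have := hf.2 hz hyΓ (by norm_num : (0 : ℝ) ≤ 1 / 2) (by norm_num : (0 : ℝ) ≤ 1 / 2)
    (by norm_num)
  simp only [smul_eq_mul] at this
  linarith

lemma isClosed_superlevel_of_limsup_lt {E : Type*} [TopologicalSpace E]
    {Γ : Set E} {f : E → ℝ} {σ : ℝ} (hΓ : IsOpen Γ) (hfc : ContinuousOn f Γ)
    (hbdd : ∀ x ∈ frontier Γ, IsBoundedUnder (· ≤ ·) (nhdsWithin x Γ) f)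
    (hσ : ∀ x ∈ frontier Γ, limsup f (nhdsWithin x Γ) < σ) :
    IsClosed {x | x ∈ Γ ∧ σ ≤ f x} := by
  rw [isClosed_iff_frequently]
  intro x hx
  have hxΓ : x ∈ Γ := by
    by_contra hxΓ
    have hfr : x ∈ frontier Γ := by
      rw [hΓ.frontier_eq]
      exact ⟨mem_closure_iff_frequently.2 (hx.mono fun _ h => h.1), hxΓ⟩
    have h := eventually_lt_of_limsup_lt (hσ x hfr) (hbdd x hfr)
    rw [eventually_nhdsWithin_iff] at h
    obtain ⟨y, hy, hy'⟩ := (hx.and_eventually h).exists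
    exact (hy' hy.1).not_ge hy.2
  refine ⟨hxΓ, ?_⟩
  by_contra! h
  obtain ⟨y, hy, hy'⟩ := (hx.and_eventually
    ((hfc.continuousAt (hΓ.mem_nhds hxΓ)).eventually_lt_const h)).exists
  exact hy'.not_ge hy.2

/-- Monotonicity in the direction `(1, …, 1)`. -/
lemma le_apply_add_smul_one {n : ℕ} {Γ : Set (Fin n → ℝ)} {f : (Fin n → ℝ) → ℝ}
    (hf : ∀ x ∈ Γ, DifferentiableAt ℝ f x) (hfpos : ∀ x ∈ Γ, ∀ i, 0 < pd f x i)
    {μ : Fin n → ℝ} (hμ : ∀ s : ℝ, 0 ≤ s → μ + s • (1 : Fin n → ℝ) ∈ Γ) {s : ℝ} (hs : 0 ≤ s) :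
    f μ ≤ f (μ + s • (1 : Fin n → ℝ)) := by
  have hd : ∀ t : ℝ, 0 ≤ t → HasDerivAt (fun t : ℝ => f (μ + t • (1 : Fin n → ℝ)))
      (fderiv ℝ f (μ + t • (1 : Fin n → ℝ)) 1) t := by
    intro t ht
    have h1 : HasDerivAt (fun t : ℝ => μ + t • (1 : Fin n → ℝ)) 1 t := by
      simpa using ((hasDerivAt_id t).smul_const (1 : Fin n → ℝ)).const_add μ
    exact (hf _ (hμ t ht)).hasFDerivAt.comp_hasDerivAt t h1
  have hmono : MonotoneOn (fun t : ℝ => f (μ + t • (1 : Fin n → ℝ))) (Ici 0) := by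
    refine monotoneOn_of_deriv_nonneg (convex_Ici 0)
      (fun t ht => (hd t ht).continuousAt.continuousWithinAt)
      (fun t ht => ?_) (fun t ht => ?_)
    · exact (hd t (interior_subset ht)).differentiableAt.differentiableWithinAt
    · have ht' : (0 : ℝ) ≤ t := interior_subset (s := Ici (0 : ℝ)) ht
      have hone : (1 : Fin n → ℝ) = ∑ i, Pi.single i 1 :=
        (Finset.univ_sum_single (1 : Fin n → ℝ)).symm
      rw [(hd t ht').deriv]
      nth_rewrite 2 [hone]
      rw [map_sum]
      exact Finset.sum_nonneg fun i _ => (hfpos _ (hμ t ht') i).le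
  simpa using hmono (mem_Ici.2 le_rfl) (mem_Ici.2 hs) hs

lemma exists_euclNorm_add_smul_one_eq {n : ℕ} (hn : 0 < n) {μ : Fin n → ℝ} {R : ℝ}
    (hR : euclNorm μ < R) : ∃ s : ℝ, 0 ≤ s ∧ euclNorm (μ + s • (1 : Fin n → ℝ)) = R := by
  have hR0 : 0 ≤ R := (Real.sqrt_nonneg _).trans hR.le
  set S : ℝ := R + |μ ⟨0, hn⟩| with hS
  have hS0 : 0 ≤ S := by positivity
  have hc : Continuous fun s : ℝ => euclNorm (μ + s • (1 : Fin n → ℝ)) :=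
    continuous_euclNorm.comp (by fun_prop)
  have hbig : R ≤ euclNorm (μ + S • (1 : Fin n → ℝ)) := by
    refine le_trans ?_ (abs_apply_le_euclNorm _ ⟨0, hn⟩)
    refine le_trans ?_ (le_abs_self _)
    simp only [Pi.add_apply, Pi.smul_apply, Pi.one_apply, smul_eq_mul, mul_one]
    linarith [neg_abs_le (μ ⟨0, hn⟩)]
  obtain ⟨s, hs, hsR⟩ := intermediate_value_Icc hS0 hc.continuousOn
    (show R ∈ Icc _ _ from ⟨by simpa using hR.le, hbig⟩)
  exact ⟨s, hs.1, hsR⟩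

lemma Convex.add_mem_of_cone {E : Type*} [AddCommGroup E] [Module ℝ E] {Γ : Set E}
    (hΓ : Convex ℝ Γ) (hcone : ∀ t : ℝ, 0 < t → ∀ x ∈ Γ, t • x ∈ Γ) {x y : E}
    (hx : x ∈ Γ) (hy : y ∈ Γ) : x + y ∈ Γ := by
  have h := hΓ (hcone 2 two_pos x hx) (hcone 2 two_pos y hy)
    (by norm_num : (0 : ℝ) ≤ 1 / 2) (by norm_num : (0 : ℝ) ≤ 1 / 2) (by norm_num)
  simpa [smul_smul] using h

lemma neg_notMem_of_proper_cone {E : Type*} [NormedAddCommGroup E] [NormedSpace ℝ E]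
    {Γ : Set E} (hΓopen : IsOpen Γ) (hΓ : Convex ℝ Γ)
    (hcone : ∀ t : ℝ, 0 < t → ∀ x ∈ Γ, t • x ∈ Γ) (hproper : Γ ≠ univ) {x : E} (hx : x ∈ Γ) :
    -x ∉ Γ := by
  intro hx'
  have h0 : (0 : E) ∈ Γ := by simpa using hΓ.add_mem_of_cone hcone hx hx'
  refine hproper (eq_univ_of_forall fun y => ?_)
  have hc : Tendsto (fun t : ℝ => t • y) (nhdsWithin 0 (Ioi 0)) (nhds 0) := by
    have : Continuous fun t : ℝ => t • y := by fun_prop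
    simpa using (this.tendsto 0).mono_left nhdsWithin_le_nhds
  obtain ⟨t, ht, ht0⟩ :=
    ((hc.eventually (hΓopen.mem_nhds h0)).and self_mem_nhdsWithin).exists
  have ht0' : (0 : ℝ) < t := ht0
  simpa [smul_smul, ht0'.ne'] using hcone t⁻¹ (inv_pos.2 ht0') _ ht

/-- A concave function taking the same value at both endpoints and at the midpoint of a segment is
constant on that segment. -/
lemma ConcaveOn.eq_const_of_midpoint {E : Type*} [AddCommGroup E] [Module ℝ E]
    {Γ : Set E} {f : E → ℝ} {c : ℝ} (hf : ConcaveOn ℝ Γ f) {x y : E} (hx : x ∈ Γ) (hy : y ∈ Γ)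
    (hfx : f x = c) (hfy : f y = c) (hm : f ((1 / 2 : ℝ) • x + (1 / 2 : ℝ) • y) ≤ c)
    {t : ℝ} (ht : t ∈ Icc (0 : ℝ) 1) : f (t • x + (1 - t) • y) = c := by
  have key : ∀ t ∈ Icc (0 : ℝ) 1, t • x + (1 - t) • y ∈ Γ ∧ c ≤ f (t • x + (1 - t) • y) := by
    intro t ht
    refine ⟨hf.1 hx hy ht.1 (sub_nonneg.2 ht.2) (by ring), ?_⟩
    have := hf.2 hx hy ht.1 (sub_nonneg.2 ht.2) (by ring)
    simp only [hfx, hfy, smul_eq_mul] at this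
    linarith
  have h1 := key t ht
  have h2 := key (1 - t) ⟨by linarith [ht.2], by linarith [ht.1]⟩
  have h3 := hf.2 h1.1 h2.1 (by norm_num : (0 : ℝ) ≤ 1 / 2) (by norm_num : (0 : ℝ) ≤ 1 / 2)
    (by norm_num)
  have h4 : (1 / 2 : ℝ) • (t • x + (1 - t) • y) + (1 / 2 : ℝ) • ((1 - t) • x + (1 - (1 - t)) • y)
      = (1 / 2 : ℝ) • x + (1 / 2 : ℝ) • y := by module
  rw [h4] at h3
  simp only [smul_eq_mul] at h3
  linarith [h1.2, h2.2]

lemma isCompact_sphere_inter_level {n : ℕ} {Γ : Set (Fin n → ℝ)} {f : (Fin n → ℝ) → ℝ} {σ : ℝ}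
    (hfc : ContinuousOn f Γ) (hC : IsClosed {x | x ∈ Γ ∧ σ ≤ f x}) (R : ℝ) :
    IsCompact {l : Fin n → ℝ | euclNorm l = R ∧ l ∈ Γ ∧ f l = σ} := by
  have hlevel : IsClosed ({x | x ∈ Γ ∧ σ ≤ f x} ∩ f ⁻¹' {σ}) :=
    (hfc.mono fun _ h => h.1).preimage_isClosed_of_isClosed hC isClosed_singleton
  refine (isCompact_Icc (a := fun _ : Fin n => -R) (b := fun _ => R)).of_isClosed_subset ?_ ?_
  · convert (isClosed_eq continuous_euclNorm (continuous_const (y := R))).inter hlevel using 1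
    ext x
    exact ⟨fun h => ⟨h.1, ⟨h.2.1, h.2.2.ge⟩, h.2.2⟩, fun h => ⟨h.1, h.2.1.1, h.2.2⟩⟩
  · intro x hx
    have h : ∀ i, |x i| ≤ R := fun i => hx.1 ▸ abs_apply_le_euclNorm x i
    exact ⟨fun i => (abs_le.1 (h i)).1, fun i => (abs_le.1 (h i)).2⟩

lemma exists_sphere_inter_level {n : ℕ} (hn : 2 ≤ n) {Γ : Set (Fin n → ℝ)}
    {f : (Fin n → ℝ) → ℝ} {σ R : ℝ} (hΓ : IsOpen Γ) (hfc : ContinuousOn f Γ)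
    (hC : IsClosed {x | x ∈ Γ ∧ σ ≤ f x}) {p q : Fin n → ℝ} (hp : euclNorm p = R)
    (hpΓ : p ∈ Γ) (hpσ : σ ≤ f p) (hq : euclNorm q = R) (hqΓ : q ∉ Γ) :
    ∃ l, euclNorm l = R ∧ l ∈ Γ ∧ f l = σ := by
  by_contra! hno
  have hU : IsOpen (Γ ∩ f ⁻¹' Ioi σ) := hfc.isOpen_inter_preimage hΓ isOpen_Ioi
  obtain ⟨x, -, hxU, hxV⟩ := isPreconnected_euclNorm_sphere hn R _ _ hU hC.isOpen_compl
    (fun x hx => by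
      by_cases h : x ∈ Γ ∧ σ ≤ f x
      · exact Or.inl ⟨h.1, lt_of_le_of_ne h.2 (hno x hx h.1).symm⟩
      · exact Or.inr h)
    ⟨p, hp, hpΓ, lt_of_le_of_ne hpσ (hno p hp hpΓ).symm⟩ ⟨q, hq, fun h => hqΓ h.1⟩
  exact hxV ⟨hxU.1, le_of_lt hxU.2⟩

/-- For `μ ∈ ∂Γ^σ` and `R > |μ|`: `∂B_R(0) ∩ ∂Γ^σ` is compact, and `Θ_R(μ) = 0` iff the open
segment from `μ` to some `λ ∈ ∂B_R(0) ∩ ∂Γ^σ` is contained in `∂Γ^σ`. -/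
theorem theta_zero_iff
    (n : ℕ) (hn : 2 ≤ n) (Γ : Set (Fin n → ℝ))
    (hΓopen : IsOpen Γ) (hΓconv : Convex ℝ Γ)
    (hΓcone : ∀ t : ℝ, 0 < t → ∀ x ∈ Γ, t • x ∈ Γ)
    (hΓsymm : ∀ π : Equiv.Perm (Fin n), ∀ x ∈ Γ, x ∘ π ∈ Γ)
    (hΓpos : {x : Fin n → ℝ | ∀ i, 0 < x i} ⊆ Γ)
    (hΓproper : Γ ≠ Set.univ) (hΓbd : (frontier Γ).Nonempty)
    (f : (Fin n → ℝ) → ℝ)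
    (hf1 : ContDiffOn ℝ 1 f Γ)
    (hfsymm : ∀ π : Equiv.Perm (Fin n), ∀ x ∈ Γ, f (x ∘ π) = f x)
    (hfpos : ∀ x ∈ Γ, ∀ i, 0 < pd f x i)
    (hfconc : ConcaveOn ℝ Γ f)
    (σ : ℝ)
    (hσ : ∀ μ₀ ∈ frontier Γ, Filter.limsup f (nhdsWithin μ₀ Γ) < σ)
    (hΓσne : {x | x ∈ Γ ∧ σ < f x}.Nonempty)
    (μ : Fin n → ℝ) (hμΓ : μ ∈ Γ) (hμσ : f μ = σ) (R : ℝ) (hR : euclNorm μ < R) :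
    IsCompact {l : Fin n → ℝ | euclNorm l = R ∧ l ∈ Γ ∧ f l = σ} ∧
    (Theta Γ f σ μ R = 0 ↔ ∃ l : Fin n → ℝ, euclNorm l = R ∧ l ∈ Γ ∧ f l = σ ∧
      ∀ t ∈ Set.Ioo (0 : ℝ) 1,
        (t • μ + (1 - t) • l ∈ Γ ∧ f (t • μ + (1 - t) • l) = σ)) := by
  have hfc : ContinuousOn f Γ := hf1.continuousOn
  have hC : IsClosed {x | x ∈ Γ ∧ σ ≤ f x} :=
    isClosed_superlevel_of_limsup_lt hΓopen hfc (fun x hx =>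
      hfconc.isBoundedUnder_nhdsWithin hΓopen hfc ⟨μ, hμΓ⟩ (frontier_subset_closure hx)) hσ
  have hK := isCompact_sphere_inter_level hfc hC R
  have hne : {l : Fin n → ℝ | euclNorm l = R ∧ l ∈ Γ ∧ f l = σ}.Nonempty := by
    have hray : ∀ s : ℝ, 0 ≤ s → μ + s • (1 : Fin n → ℝ) ∈ Γ := by
      intro s hs
      rcases hs.eq_or_lt with rfl | hs
      · simpa using hμΓ
      · exact hΓconv.add_mem_of_cone hΓcone hμΓ (hΓpos fun i => by simpa using hs)
    obtain ⟨s, hs, hsR⟩ := exists_euclNorm_add_smul_one_eq (by omega) hR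
    have hle := le_apply_add_smul_one
      (fun x hx => (hf1.contDiffAt (hΓopen.mem_nhds hx)).differentiableAt one_ne_zero)
      hfpos hray hs
    exact exists_sphere_inter_level hn hΓopen hfc hC hsR (hray s hs) (hμσ ▸ hle)
      (q := -(μ + s • (1 : Fin n → ℝ))) (by simpa [euclNorm_eq_norm, -neg_add_rev] using hsR)
      (neg_notMem_of_proper_cone hΓopen hΓconv hΓcone hΓproper (hray s hs))
  have hseg : ∀ l ∈ Γ, ∀ t ∈ Icc (0 : ℝ) 1, t • μ + (1 - t) • l ∈ Γ := fun l hl t ht =>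
    hΓconv hμΓ hl ht.1 (sub_nonneg.2 ht.2) (by ring)
  have hle_sup : ∀ l ∈ Γ, ∀ t ∈ Icc (0 : ℝ) 1, f (t • μ + (1 - t) • l) - σ ≤
      sSup ((fun t : ℝ => f (t • μ + (1 - t) • l) - σ) '' Icc 0 1) := by
    intro l hl t ht
    refine le_csSup (IsCompact.bddAbove (isCompact_Icc.image_of_continuousOn ?_))
      (mem_image_of_mem _ ht)
    exact (hfc.comp (by fun_prop) (hseg l hl)).sub continuousOn_const
  have hnonneg : ∀ l ∈ Γ, 0 ≤ sSup ((fun t : ℝ => f (t • μ + (1 - t) • l) - σ) '' Icc 0 1) := by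
    intro l hl
    simpa [hμσ] using hle_sup l hl 1 (by simp)
  refine ⟨hK, fun h => ?_, ?_⟩
  · have hhalf : (1 / 2 : ℝ) ∈ Icc (0 : ℝ) 1 := by norm_num
    obtain ⟨l₀, hl₀, hmin⟩ := hK.exists_isMinOn hne
      (f := fun l => f ((1 / 2 : ℝ) • μ + (1 - 1 / 2 : ℝ) • l))
      (hfc.comp (by fun_prop) fun l hl => hseg l hl.2.1 _ hhalf)
    have hmid : f ((1 / 2 : ℝ) • μ + (1 - 1 / 2 : ℝ) • l₀) - σ ≤ 0 := by
      rw [← h]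
      refine le_csInf (hne.image _) ?_
      rintro _ ⟨l, hl, rfl⟩
      exact (sub_le_sub_right (hmin hl) σ).trans (hle_sup l hl.2.1 _ hhalf)
    rw [sub_nonpos, show (1 - 1 / 2 : ℝ) = 1 / 2 by norm_num] at hmid
    exact ⟨l₀, hl₀.1, hl₀.2.1, hl₀.2.2, fun t ht => ⟨hseg l₀ hl₀.2.1 t (Ioo_subset_Icc_self ht),
      hfconc.eq_const_of_midpoint hμΓ hl₀.2.1 hμσ hl₀.2.2 hmid (Ioo_subset_Icc_self ht)⟩⟩
  · rintro ⟨l, hlR, hlΓ, hlσ, hl⟩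
    refine IsLeast.csInf_eq ⟨⟨l, ⟨hlR, hlΓ, hlσ⟩, le_antisymm ?_ (hnonneg l hlΓ)⟩, ?_⟩
    · refine csSup_le ((nonempty_Icc.2 zero_le_one).image _) ?_
      rintro _ ⟨t, ht, rfl⟩
      rcases ht.1.eq_or_lt with rfl | h0
      · simp [hlσ]
      rcases ht.2.eq_or_lt with rfl | h1
      · simp [hμσ]
      · simp [(hl t ⟨h0, h1⟩).2]
    · rintro _ ⟨l', hl', rfl⟩
      exact hnonneg l' hl'.2.1
end
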